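/- arXiv:2104.10005 — 6 statements merged into one kernel-verified Lean document; each statement's English description precedes it below -/
import Mathlib

section
/- Let n ≥ 4 and let a_1 ≥ a_2 ≥ ... ≥ a_n > 0 be reals with Σ_{i=1}^n a_i^2 = 1, a_1 + a_2 + a_3 < 1, and a_3 = 1/3 - δ where 0 < δ ≤ 1/120. Let k be the smallest index with a_k < 1 - a_1 - a_2 - a_3 (with k = n + 1 if no such index exists). If Σ_{i=k}^n a_i^2 < 450 δ^2, then k ≥ 11. -/
open Finset

/-- Two squares of numbers at least `m` whose sum is at most `2 * m + c` are largest at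
`m` and `m + c`. -/
lemma sq_add_sq_le_of_le_of_add_le {x y m c : ℝ} (hm : 0 ≤ m) (hx : m ≤ x) (hy : m ≤ y)
    (hxy : x + y ≤ 2 * m + c) : x ^ 2 + y ^ 2 ≤ m ^ 2 + (m + c) ^ 2 := by
  have h1 : 0 ≤ (x - m) * (y - m) := mul_nonneg (by linarith) (by linarith)
  have h2 : (x + y - m) ^ 2 ≤ (m + c) ^ 2 := pow_le_pow_left₀ (by linarith) (by linarith) 2
  linarith

lemma card_filter_fin_le_sub (n l m : ℕ) :
    (univ.filter (fun i : Fin n => l ≤ (i : ℕ) ∧ (i : ℕ) < m)).card ≤ m - l := by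
  rw [← Nat.card_Ico]
  refine card_le_card_of_injOn (fun i => (i : ℕ)) (fun i hi => ?_) Fin.val_injective.injOn
  simpa using hi

/-- Split a sum over `Fin n` into its first three terms, the terms below `m`, and the rest. -/
lemma sum_fin_le_first_three_add (n : ℕ) (hn : 3 ≤ n) (m : ℕ) (f : Fin n → ℝ)
    (hf : ∀ i, 0 ≤ f i) :
    ∑ i, f i ≤ f ⟨0, by omega⟩ + f ⟨1, by omega⟩ + f ⟨2, by omega⟩
      + ∑ i ∈ univ.filter (fun i : Fin n => 3 ≤ (i : ℕ) ∧ (i : ℕ) < m), f i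
      + ∑ i ∈ univ.filter (fun i : Fin n => m ≤ (i : ℕ)), f i := by
  have hfirst : ∑ i ∈ univ.filter (fun i : Fin n => (i : ℕ) < 3), f i
      = f ⟨0, by omega⟩ + f ⟨1, by omega⟩ + f ⟨2, by omega⟩ := by
    have hset : univ.filter (fun i : Fin n => (i : ℕ) < 3)
        = {⟨0, by omega⟩, ⟨1, by omega⟩, ⟨2, by omega⟩} := by
      ext i
      simp only [mem_filter, mem_univ, true_and, mem_insert, mem_singleton, Fin.ext_iff]
      omega
    rw [hset, sum_insert (by simp), sum_pair (by simp), add_assoc]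
  rw [← hfirst, sum_filter, sum_filter, sum_filter, ← sum_add_distrib, ← sum_add_distrib]
  refine sum_le_sum fun i _ => ?_
  have := hf i
  split_ifs <;> first | linarith | omega

/-- **Claim (small tail mass forces `k ≥ 11`).**
Let `n ≥ 4`, `a_1 ≥ ... ≥ a_n > 0` (0-indexed below) with `Σ a_i² = 1`,
`a_1 + a_2 + a_3 < 1`, `a_3 = 1/3 - δ` with `0 < δ ≤ 1/120`. Let `k` (1-based) be the
smallest index with `a_k < 1 - a_1 - a_2 - a_3` (`k = n + 1` if there is none).
If `Σ_{i=k}^n a_i² < 450 δ²`, then `k ≥ 11`. -/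
theorem tail_mass_small_implies_k_ge_eleven
    (n : ℕ) (hn : 4 ≤ n) (δ : ℝ) (hδ0 : 0 < δ) (hδ : δ ≤ 1 / 120)
    (a : Fin n → ℝ)
    (hpos : ∀ i, 0 < a i)
    (hmono : ∀ i j : Fin n, i ≤ j → a j ≤ a i)
    (hsum : ∑ i, a i ^ 2 = 1)
    (h123 : a ⟨0, by omega⟩ + a ⟨1, by omega⟩ + a ⟨2, by omega⟩ < 1)
    (h3 : a ⟨2, by omega⟩ = 1 / 3 - δ)
    (k : ℕ) (hkn : k ≤ n + 1)
    (hklt : ∀ i : Fin n, (i : ℕ) + 1 < k →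
      1 - a ⟨0, by omega⟩ - a ⟨1, by omega⟩ - a ⟨2, by omega⟩ ≤ a i)
    (hkge : ∀ i : Fin n, k ≤ (i : ℕ) + 1 →
      a i < 1 - a ⟨0, by omega⟩ - a ⟨1, by omega⟩ - a ⟨2, by omega⟩)
    (htail : ∑ i ∈ Finset.univ.filter (fun i : Fin n => k ≤ (i : ℕ) + 1), a i ^ 2 <
      450 * δ ^ 2) :
    11 ≤ k := by
  by_contra! hk
  set m : ℝ := 1 / 3 - δ with hm
  have h0 : m ≤ a ⟨0, by omega⟩ := h3 ▸ hmono _ _ (by simp)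
  have h1 : m ≤ a ⟨1, by omega⟩ := h3 ▸ hmono _ _ (by simp)
  have hhead := sq_add_sq_le_of_le_of_add_le (c := 3 * δ) (by linarith) h0 h1 (by linarith)
  have hmid : ∑ i ∈ univ.filter (fun i : Fin n => 3 ≤ (i : ℕ) ∧ (i : ℕ) < k - 1), a i ^ 2
      ≤ 6 * m ^ 2 := by
    refine (sum_le_card_nsmul _ _ (m ^ 2) fun i hi => ?_).trans ?_
    · have hi3 := (mem_filter.1 hi).2.1
      exact pow_le_pow_left₀ (hpos i).le (h3 ▸ hmono _ _ (Fin.le_def.2 (by simp; omega))) 2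
    · rw [nsmul_eq_mul]
      gcongr
      exact_mod_cast (card_filter_fin_le_sub n 3 (k - 1)).trans (by omega)
  have hsplit := sum_fin_le_first_three_add n (by omega) (k - 1) (fun i => a i ^ 2)
    fun i => sq_nonneg _
  simp only [Nat.sub_le_iff_le_add, hsum, h3] at hsplit
  have hδ2 : δ * δ ≤ 1 / 120 * δ := mul_le_mul_of_nonneg_right hδ hδ0.le
  rw [hm] at hhead hmid hsplit
  linarith
end

section
/- Let n ≥ 10 and let a_1 ≥ a_2 ≥ ... ≥ a_n > 0 be reals with Σ_{i=1}^n a_i^2 = 1, a_1 + a_2 + a_3 < 1, and a_3 = 1/3 - δ where 0 < δ ≤ 1/120. Assume that a_i ≥ 1 - a_1 - a_2 - a_3 for all i ≤ 10 and that a_8 + a_9 + a_10 ≥ 2/3 + δ. Let Y = Σ_{i=4}^n a_i ε_i with ε_4, ..., ε_n independent uniform random signs. Then Pr[|Y| ≥ 1 - a_1 - a_2 + a_3] ≥ 37/128 and Pr[|Y| ≥ 1 - a_1 + a_2 - a_3] ≥ 37/128. -/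
open Finset

/-- The sign encoded by a Boolean. -/
noncomputable def boolSign (b : Bool) : ℝ := if b then 1 else -1

@[simp] lemma boolSign_true : boolSign true = 1 := rfl

@[simp] lemma boolSign_false : boolSign false = -1 := by simp [boolSign]

lemma boolSign_beq (b c : Bool) : boolSign (b == c) = boolSign b * boolSign c := by
  cases b <;> cases c <;> simp

lemma abs_boolSign (b : Bool) : |boolSign b| = 1 := by
  cases b <;> simp

section SignCount

variable {ι κ : Type*} [Fintype ι] [DecidableEq ι] [Fintype κ] [DecidableEq κ]

/-- The number of sign patterns for which the signed sum of the weights `c` is at least `t`. -/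
noncomputable def signCount (c : ι → ℝ) (t : ℝ) : ℕ :=
  #{e : ι → Bool | t ≤ ∑ i, c i * boolSign (e i)}

lemma signCount_anti (c : ι → ℝ) {s t : ℝ} (h : s ≤ t) : signCount c t ≤ signCount c s := by
  refine card_le_card fun e he => ?_
  simp only [mem_filter_univ] at he ⊢
  exact h.trans he

/-- Flipping a fixed set of signs permutes the sign patterns. -/
def signFlip (g : ι → Bool) : (ι → Bool) ≃ (ι → Bool) where
  toFun e i := e i == g i
  invFun e i := e i == g i
  left_inv e := by ext i; simp
  right_inv e := by ext i; simp

lemma card_filter_signFlip (g : ι → Bool) (p : (ι → Bool) → Prop) [DecidablePred p] :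
    #{e | p (signFlip g e)} = #{e | p e} := by
  simpa only [card_filter] using
    (signFlip g).sum_comp fun e => if p e then 1 else 0

lemma signCount_congr_abs {c d : ι → ℝ} (h : ∀ i, |c i| = |d i|) (t : ℝ) :
    signCount c t = signCount d t := by
  rw [signCount, signCount, ← card_filter_signFlip (fun i => decide (c i = d i))]
  congr 1
  ext e
  simp only [mem_filter_univ]
  refine iff_of_eq (congrArg _ (sum_congr rfl fun i _ => ?_))
  rcases eq_or_ne (c i) (d i) with hi | hi
  · simp [signFlip, hi]
  · have := (abs_eq_abs.1 (h i)).resolve_left hi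
    simp only [signFlip, Equiv.coe_fn_mk, boolSign_beq, decide_eq_false hi, boolSign_false]
    rw [this]
    ring

lemma card_filter_le_neg (c : ι → ℝ) (t : ℝ) :
    #{e : ι → Bool | ∑ i, c i * boolSign (e i) ≤ -t} = signCount c t := by
  rw [signCount, ← card_filter_signFlip (fun _ => false)]
  congr 1
  ext e
  simp only [signFlip, Equiv.coe_fn_mk, mem_filter_univ, boolSign_beq, boolSign_false]
  simp

lemma two_mul_signCount_le (c : ι → ℝ) {t : ℝ} (ht : 0 < t) :
    2 * signCount c t ≤ #{e : ι → Bool | t ≤ |∑ i, c i * boolSign (e i)|} := by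
  have hd : Disjoint ({e : ι → Bool | t ≤ ∑ i, c i * boolSign (e i)} : Finset _)
      ({e : ι → Bool | ∑ i, c i * boolSign (e i) ≤ -t} : Finset _) := by
    refine disjoint_filter.2 fun e _ h1 h2 => ?_
    linarith
  calc 2 * signCount c t = signCount c t + signCount c t := two_mul _
    _ = #(({e : ι → Bool | t ≤ ∑ i, c i * boolSign (e i)} : Finset _) ∪
          ({e : ι → Bool | ∑ i, c i * boolSign (e i) ≤ -t} : Finset _)) := by
      rw [card_union_of_disjoint hd, card_filter_le_neg, signCount]
    _ ≤ _ := by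
      refine card_le_card fun e he => ?_
      simp only [mem_union, mem_filter_univ, le_abs] at he ⊢
      exact he.imp_right le_neg_of_le_neg

lemma two_pow_card_le_two_mul_signCount_zero (c : ι → ℝ) :
    2 ^ Fintype.card ι ≤ 2 * signCount c 0 := by
  calc 2 ^ Fintype.card ι = #(univ : Finset (ι → Bool)) := by simp
    _ ≤ #(({e : ι → Bool | 0 ≤ ∑ i, c i * boolSign (e i)} : Finset _) ∪
          ({e : ι → Bool | ∑ i, c i * boolSign (e i) ≤ -0} : Finset _)) := by
      refine card_le_card fun e _ => ?_
      simpa using le_total _ _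
    _ ≤ _ := card_union_le _ _
    _ = _ := by rw [card_filter_le_neg, two_mul, signCount]

/-- Averaging over block sign flips: a lower bound for the signed block sums that holds for every
sign pattern inside the blocks gives a lower bound for the whole sum. -/
lemma mul_two_pow_le_signCount (c : ι → ℝ) (t : ℝ) (f : ι → κ) (m : ℕ)
    (h : ∀ e : ι → Bool, m ≤ signCount (fun k => ∑ i with f i = k, c i * boolSign (e i)) t) :
    m * 2 ^ Fintype.card ι ≤ 2 ^ Fintype.card κ * signCount c t := by
  have key (e : ι → Bool) (g : κ → Bool) :
      ∑ k, (∑ i with f i = k, c i * boolSign (e i)) * boolSign (g k) =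
        ∑ i, c i * boolSign (signFlip (fun i => g (f i)) e i) := by
    rw [← sum_fiberwise univ f]
    refine sum_congr rfl fun k _ => ?_
    rw [sum_mul]
    refine sum_congr rfl fun i hi => ?_
    simp only [mem_filter_univ] at hi
    simp [signFlip, boolSign_beq, hi, mul_assoc]
  calc m * 2 ^ Fintype.card ι = ∑ _e : ι → Bool, m := by simp [mul_comm]
    _ ≤ ∑ e : ι → Bool, signCount (fun k => ∑ i with f i = k, c i * boolSign (e i)) t :=
      sum_le_sum fun e _ => h e
    _ = ∑ g : κ → Bool, signCount c t := by
      simp only [signCount, key, card_filter]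
      rw [sum_comm]
      refine sum_congr rfl fun g _ => ?_
      exact (signFlip fun i => g (f i)).sum_comp
        fun e => if t ≤ ∑ i, c i * boolSign (e i) then 1 else 0
    _ = _ := by simp

lemma signCount_sum (c : ι ⊕ κ → ℝ) (t : ℝ) :
    signCount c t = ∑ e : ι → Bool,
      signCount (fun k => c (.inr k)) (t - ∑ i, c (.inl i) * boolSign (e i)) := by
  simp only [signCount, card_filter]
  rw [← Fintype.sum_prod_type'
    (f := fun (e : ι → Bool) (g : κ → Bool) =>
      if t - ∑ i, c (.inl i) * boolSign (e i) ≤ ∑ k, c (.inr k) * boolSign (g k) then 1 else 0)]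
  refine Fintype.sum_equiv (Equiv.sumArrowEquivProdArrow ι κ Bool) _ _ fun e => ?_
  simp [Equiv.sumArrowEquivProdArrow, add_comm]

end SignCount

lemma one_le_signCount_five {q : Fin 5 → ℝ} {u : ℝ} (h : u ≤ q 0 + q 1 + q 2 + q 3 + q 4) :
    1 ≤ signCount q u := by
  refine card_pos.2 ⟨fun _ => true, ?_⟩
  simpa [boolSign, Fin.sum_univ_five] using h

/-- If the last weight is very large, it replaces two of the others; otherwise the sums with at most
one negative large weight suffice, unless the first weight is too large to be negative. -/
lemma six_le_signCount_five {q : Fin 5 → ℝ} {b : ℝ} (hb : b ≤ q 3) (h32 : q 3 ≤ q 2)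
    (h21 : q 2 ≤ q 1) (h10 : q 1 ≤ q 0) (hz : 0 ≤ q 4) :
    6 ≤ signCount q (2 * b) := by
  rcases le_total (q 0 + q 1 + q 2 + q 3 - 2 * b) (q 4) with hz' | hz'
  · calc 6 = #({![true, true, false, false, true],
          ![true, false, true, false, true],
          ![true, false, false, true, true],
          ![false, true, true, false, true],
          ![false, true, false, true, true],
          ![false, false, true, true, true]} :
          Finset (Fin 5 → Bool)) := by decide
      _ ≤ _ := by
        refine card_le_card fun e he => ?_
        simp only [mem_insert, mem_singleton] at he
        rcases he with rfl | rfl | rfl | rfl | rfl | rfl <;>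
        · simp [boolSign, Fin.sum_univ_five]
          linarith
  rcases le_total (2 * b) (-q 0 + q 1 + q 2 + q 3 + q 4) with h0 | h0
  · calc 6 = #({![true, true, true, true, false],
          ![true, true, true, true, true],
          ![false, true, true, true, true],
          ![true, false, true, true, true],
          ![true, true, false, true, true],
          ![true, true, true, false, true]} :
          Finset (Fin 5 → Bool)) := by decide
      _ ≤ _ := by
        refine card_le_card fun e he => ?_
        simp only [mem_insert, mem_singleton] at he
        rcases he with rfl | rfl | rfl | rfl | rfl | rfl <;>
        · simp [boolSign, Fin.sum_univ_five]
          linarith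
  · calc 6 = #({![true, true, true, true, false],
          ![true, true, true, true, true],
          ![true, true, true, false, false],
          ![true, false, true, true, true],
          ![true, true, false, true, true],
          ![true, true, true, false, true]} :
          Finset (Fin 5 → Bool)) := by decide
      _ ≤ _ := by
        refine card_le_card fun e he => ?_
        simp only [mem_insert, mem_singleton] at he
        rcases he with rfl | rfl | rfl | rfl | rfl | rfl <;>
        · simp [boolSign, Fin.sum_univ_five]
          linarith

/-- If the three smallest of seven weights add up to at least `t`, then at least `37` of the `256`
signed sums with one further weight reach `t`. -/
lemma thirty_seven_le_signCount {c : Fin 3 ⊕ Fin 5 → ℝ} {t : ℝ}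
    (h21 : c (.inl 2) ≤ c (.inl 1)) (h10 : c (.inl 1) ≤ c (.inl 0))
    (h03 : c (.inl 0) ≤ c (.inr 3)) (h32' : c (.inr 3) ≤ c (.inr 2))
    (h21' : c (.inr 2) ≤ c (.inr 1)) (h10' : c (.inr 1) ≤ c (.inr 0)) (hz : 0 ≤ c (.inr 4))
    (ht : t ≤ c (.inl 0) + c (.inl 1) + c (.inl 2)) :
    37 ≤ signCount c t := by
  let q : Fin 5 → ℝ := fun k => c (.inr k)
  have h16 {u : ℝ} (hu : u ≤ 0) : 16 ≤ signCount q u := by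
    have h := two_pow_card_le_two_mul_signCount_zero q
    have := signCount_anti q hu
    simp only [Fintype.card_fin] at h
    omega
  have h6 {u b : ℝ} (hb : b ≤ c (.inr 3)) (hu : u ≤ 2 * b) : 6 ≤ signCount q u :=
    (six_le_signCount_five hb h32' h21' h10' hz).trans (signCount_anti q hu)
  have h1 {u : ℝ} (hu : u ≤ c (.inr 0) + c (.inr 1) + c (.inr 2) + c (.inr 3) + c (.inr 4)) :
      1 ≤ signCount q u := one_le_signCount_five hu
  rw [signCount_sum]
  calc 37 = ∑ e : Fin 3 → Bool, ![0, 1, 6, 16] (∑ i, if e i then (1 : Fin 4) else 0) := by decide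
    _ ≤ _ := sum_le_sum fun e _ => ?_
  rcases he0 : e 0 <;> rcases he1 : e 1 <;> rcases he2 : e 2 <;>
    simp only [Fin.sum_univ_three, he0, he1, he2, boolSign]
  · exact Nat.zero_le _
  · refine h1 ?_
    norm_num
    linarith
  · refine h1 ?_
    norm_num
    linarith
  · refine h6 (b := c (.inl 0)) h03 ?_
    norm_num
    linarith
  · refine h1 ?_
    norm_num
    linarith
  · refine h6 (b := c (.inl 1)) (by linarith) ?_
    norm_num
    linarith
  · refine h6 (b := c (.inl 2)) (by linarith) ?_
    norm_num
    linarith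
  · refine h16 ?_
    norm_num
    linarith

/-- The blocks of the sign flips: the weights `7, 8, 9`, then `3, 4, 5, 6`, then all others. -/
def weightBlock (i : ℕ) : Fin 3 ⊕ Fin 5 :=
  if i = 7 then .inl 0 else if i = 8 then .inl 1 else if i = 9 then .inl 2
  else if i = 3 then .inr 0 else if i = 4 then .inr 1 else if i = 5 then .inr 2
  else if i = 6 then .inr 3 else .inr 4

lemma thirty_seven_mul_two_pow_le {n : ℕ} (hn : 9 < n) {a : Fin n → ℝ} {t : ℝ}
    (hpos : ∀ i, 0 < a i) (hmono : ∀ i j : Fin n, i ≤ j → a j ≤ a i)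
    (ht : t ≤ a ⟨7, by omega⟩ + a ⟨8, by omega⟩ + a ⟨9, by omega⟩) :
    37 * 2 ^ n ≤ 256 * signCount (fun i : Fin n => if 3 ≤ (i : ℕ) then a i else 0) t := by
  have h := mul_two_pow_le_signCount (fun i : Fin n => if 3 ≤ (i : ℕ) then a i else 0) t
    (fun i => weightBlock i) 37 fun e => ?_
  · simpa using h
  have hblock (j : ℕ) (hj : j < n) (hj3 : 3 ≤ j) (hj' : j < 10) :
      |∑ i ∈ univ.filter (fun i : Fin n => weightBlock i = weightBlock j),
        (if 3 ≤ (i : ℕ) then a i else 0) * boolSign (e i)| = a ⟨j, hj⟩ := by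
    have : univ.filter (fun i : Fin n => weightBlock i = weightBlock j) = {⟨j, hj⟩} := by
      ext i
      simp only [mem_filter_univ, mem_singleton, Fin.ext_iff]
      refine ⟨fun h => ?_, fun h => by rw [h]⟩
      interval_cases j <;> simp only [weightBlock] at h <;> grind
    rw [this, sum_singleton, abs_mul, abs_boolSign, mul_one, if_pos hj3, abs_of_pos (hpos _)]
  have b7 := hblock 7 (by omega) (by omega) (by omega)
  have b8 := hblock 8 (by omega) (by omega) (by omega)
  have b9 := hblock 9 (by omega) (by omega) (by omega)
  have b3 := hblock 3 (by omega) (by omega) (by omega)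
  have b4 := hblock 4 (by omega) (by omega) (by omega)
  have b5 := hblock 5 (by omega) (by omega) (by omega)
  have b6 := hblock 6 (by omega) (by omega) (by omega)
  have mono (i j : ℕ) (hij : i ≤ j) (hj : j < n) : a ⟨j, hj⟩ ≤ a ⟨i, by omega⟩ :=
    hmono _ _ (Fin.mk_le_mk.2 hij)
  rw [signCount_congr_abs (fun k => (abs_abs _).symm)]
  apply thirty_seven_le_signCount
  · exact b9.trans_le ((mono 8 9 (by omega) (by omega)).trans_eq b8.symm)
  · exact b8.trans_le ((mono 7 8 (by omega) (by omega)).trans_eq b7.symm)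
  · exact b7.trans_le ((mono 6 7 (by omega) (by omega)).trans_eq b6.symm)
  · exact b6.trans_le ((mono 5 6 (by omega) (by omega)).trans_eq b5.symm)
  · exact b5.trans_le ((mono 4 5 (by omega) (by omega)).trans_eq b4.symm)
  · exact b4.trans_le ((mono 3 4 (by omega) (by omega)).trans_eq b3.symm)
  · exact abs_nonneg _
  · exact ht.trans_eq (congrArg₂ _ (congrArg₂ _ b7 b8) b9).symm

/-- **Claim (ten big weights with `a_8 + a_9 + a_10` large force `q_2, q_3 ≥ 37/128`).**
Let `n ≥ 10`, `a_1 ≥ ... ≥ a_n > 0` (0-indexed below) with `Σ a_i² = 1`,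
`a_1 + a_2 + a_3 < 1`, `a_3 = 1/3 - δ` with `0 < δ ≤ 1/120`. Assume
`a_i ≥ 1 - a_1 - a_2 - a_3` for all `i ≤ 10` (1-based) and `a_8 + a_9 + a_10 ≥ 2/3 + δ`.
Then for `Y = Σ_{i=4}^n a_i ε_i` (uniform measure on sign vectors `Fin n → Bool`),
both `Pr[|Y| ≥ 1 - a_1 - a_2 + a_3] ≥ 37/128` and `Pr[|Y| ≥ 1 - a_1 + a_2 - a_3] ≥ 37/128`. -/
theorem ten_big_weights_implies_q2_q3_large
    (n : ℕ) (hn : 10 ≤ n) (δ : ℝ) (hδ0 : 0 < δ) (hδ : δ ≤ 1 / 120)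
    (a : Fin n → ℝ)
    (hpos : ∀ i, 0 < a i)
    (hmono : ∀ i j : Fin n, i ≤ j → a j ≤ a i)
    (hsum : ∑ i, a i ^ 2 = 1)
    (h123 : a ⟨0, by omega⟩ + a ⟨1, by omega⟩ + a ⟨2, by omega⟩ < 1)
    (h3 : a ⟨2, by omega⟩ = 1 / 3 - δ)
    (hbig : ∀ i : Fin n, (i : ℕ) < 10 →
      1 - a ⟨0, by omega⟩ - a ⟨1, by omega⟩ - a ⟨2, by omega⟩ ≤ a i)
    (h8910 : 2 / 3 + δ ≤ a ⟨7, by omega⟩ + a ⟨8, by omega⟩ + a ⟨9, by omega⟩) :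
    (37 : ℝ) / 128 ≤
      ((Finset.univ.filter (fun ε : Fin n → Bool =>
          1 - a ⟨0, by omega⟩ - a ⟨1, by omega⟩ + a ⟨2, by omega⟩ ≤
            |∑ i ∈ Finset.univ.filter (fun i : Fin n => 3 ≤ (i : ℕ)),
              a i * (if ε i then (1 : ℝ) else -1)|)).card : ℝ) / 2 ^ n ∧
    (37 : ℝ) / 128 ≤
      ((Finset.univ.filter (fun ε : Fin n → Bool =>
          1 - a ⟨0, by omega⟩ + a ⟨1, by omega⟩ - a ⟨2, by omega⟩ ≤
            |∑ i ∈ Finset.univ.filter (fun i : Fin n => 3 ≤ (i : ℕ)),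
              a i * (if ε i then (1 : ℝ) else -1)|)).card : ℝ) / 2 ^ n := by
  have key {t : ℝ} (ht0 : 0 < t)
      (ht : t ≤ a ⟨7, by omega⟩ + a ⟨8, by omega⟩ + a ⟨9, by omega⟩) :
      (37 : ℝ) / 128 ≤
        (#{ε : Fin n → Bool | t ≤ |∑ i ∈ univ.filter (fun i : Fin n => 3 ≤ (i : ℕ)),
          a i * (if ε i then (1 : ℝ) else -1)|} : ℝ) / 2 ^ n := by
    have h1 := thirty_seven_mul_two_pow_le hn hpos hmono ht
    have h2 := two_mul_signCount_le (fun i : Fin n => if 3 ≤ (i : ℕ) then a i else 0) ht0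
    simp only [ite_mul, zero_mul, ← sum_filter, boolSign] at h2
    replace h1 := (Nat.cast_le (α := ℝ)).2 h1
    replace h2 := (Nat.cast_le (α := ℝ)).2 h2
    simp only [Nat.cast_mul, Nat.cast_pow, Nat.cast_ofNat] at h1 h2
    rw [div_le_div_iff₀ (by norm_num) (by positivity)]
    linarith
  have h01 := hmono ⟨0, by omega⟩ ⟨1, by omega⟩ (Fin.mk_le_mk.2 (by omega))
  have h12 := hmono ⟨1, by omega⟩ ⟨2, by omega⟩ (Fin.mk_le_mk.2 (by omega))
  have h2 := hpos ⟨2, by omega⟩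
  have h1 := hpos ⟨1, by omega⟩
  exact ⟨key (by linarith) (by linarith), key (by linarith) (by linarith)⟩
end

section
/- Let a_1 ≥ a_2 ≥ ... ≥ a_n > 0 be real numbers with Σ_{i=1}^n a_i^2 = 1 and a_1 ≥ 14/15, and let X = Σ_{i=1}^n a_i ε_i be the corresponding Rademacher sum. Then Pr[X ≥ 1] ≥ 7/64. -/
open Finset

/-- The value of the Rademacher sum with weights `a` at the sign vector `ε`. -/
def rademacherSum {ι : Type*} [Fintype ι] (a : ι → ℝ) (ε : ι → Bool) : ℝ :=
  ∑ i, a i * (if ε i then (1 : ℝ) else -1)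

lemma rademacherSum_not {ι : Type*} [Fintype ι] (a : ι → ℝ) (ε : ι → Bool) :
    rademacherSum a (fun i => !ε i) = -rademacherSum a ε := by
  unfold rademacherSum
  rw [← Finset.sum_neg_distrib]
  refine Finset.sum_congr rfl fun i _ => ?_
  cases h : ε i <;> simp [h]

lemma rademacherSum_sub_update {ι : Type*} [Fintype ι] [DecidableEq ι] (a : ι → ℝ)
    (ε : ι → Bool) (i : ι) :
    rademacherSum a ε - rademacherSum a (Function.update ε i (!ε i)) =
      2 * a i * (if ε i then (1 : ℝ) else -1) := by
  unfold rademacherSum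
  rw [← Finset.sum_sub_distrib, Finset.sum_eq_single i]
  · rw [Function.update_self]
    cases ε i <;> simp <;> ring
  · intro j _ hj
    rw [Function.update_of_ne hj, sub_self]
  · simp

lemma sum_cos_rademacherSum {ι : Type*} [Fintype ι] [DecidableEq ι] (a : ι → ℝ) (θ : ℝ) :
    ∑ ε : ι → Bool, Real.cos (θ * rademacherSum a ε) =
      2 ^ Fintype.card ι * ∏ i, Real.cos (θ * a i) := by
  have key : ∑ ε : ι → Bool, Complex.exp ((θ * rademacherSum a ε : ℝ) * Complex.I) =
      ((2 ^ Fintype.card ι * ∏ i, Real.cos (θ * a i) : ℝ) : ℂ) := by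
    have h := Finset.prod_univ_sum (fun _ : ι => (univ : Finset Bool))
      (fun i b => Complex.exp ((θ * (a i * (if b then (1 : ℝ) else -1)) : ℝ) * Complex.I))
    rw [Fintype.piFinset_univ] at h
    calc _ = ∑ ε : ι → Bool, ∏ i, Complex.exp
          ((θ * (a i * (if ε i then (1 : ℝ) else -1)) : ℝ) * Complex.I) := by
          refine Finset.sum_congr rfl fun ε _ => ?_
          rw [← Complex.exp_sum, ← Finset.sum_mul, ← Complex.ofReal_sum, ← Finset.mul_sum]
          rfl
      _ = ∏ i, ((2 * Real.cos (θ * a i) : ℝ) : ℂ) := by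
          rw [← h]
          refine Finset.prod_congr rfl fun i _ => ?_
          rw [Fintype.sum_bool]
          push_cast
          rw [Complex.two_cos]
          simp
      _ = _ := by
          rw [← Complex.ofReal_prod, Finset.prod_mul_distrib]
          simp
  have h := congrArg Complex.re key
  rw [Complex.re_sum, Complex.ofReal_re] at h
  simpa only [Complex.exp_ofReal_mul_I_re] using h

lemma cos_le_exp_neg_mul_sq {x : ℝ} (hx : x ^ 2 ≤ 1 / 2) :
    Real.cos x ≤ Real.exp (-(4 / 9 * x ^ 2)) := by
  have hx1 : |x| ≤ 1 := (sq_le_one_iff_abs_le_one x).1 (by linarith)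
  have h := (abs_le.1 (Real.cos_bound hx1)).2
  have h4 : |x| ^ 4 = x ^ 2 * x ^ 2 := by rw [← sq_abs x]; ring
  rw [h4] at h
  have := Real.add_one_le_exp (-(4 / 9 * x ^ 2))
  nlinarith [sq_nonneg x]

/-- A sum whose weights are all small has a small characteristic function. -/
lemma prod_cos_le {ι : Type*} [Fintype ι] (a : ι → ℝ) (θ : ℝ)
    (hsmall : ∀ i, (θ * a i) ^ 2 ≤ 1 / 2) (hθ : θ ^ 2 * ∑ i, a i ^ 2 = 9) :
    ∏ i, Real.cos (θ * a i) ≤ 1 / 50 := by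
  calc ∏ i, Real.cos (θ * a i) ≤ ∏ i, Real.exp (-(4 / 9 * (θ * a i) ^ 2)) := by
        refine Finset.prod_le_prod (fun i _ => ?_) fun i _ => cos_le_exp_neg_mul_sq (hsmall i)
        linarith [Real.one_sub_sq_div_two_le_cos (x := θ * a i), hsmall i]
    _ = Real.exp (-4) := by
        rw [← Real.exp_sum]
        congr 1
        simp_rw [mul_pow]
        rw [Finset.sum_neg_distrib, ← Finset.mul_sum, ← Finset.mul_sum, hθ]
        norm_num
    _ ≤ 1 / 50 := by
        have h : (50 : ℝ) ≤ Real.exp 4 := by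
          have h4 : Real.exp 4 = Real.exp 1 ^ 4 := by rw [← Real.exp_nat_mul]; norm_num
          rw [h4]
          calc (50 : ℝ) ≤ (2.7 : ℝ) ^ 4 := by norm_num
            _ ≤ _ := by gcongr; linarith [Real.exp_one_gt_d9]
        rw [Real.exp_neg, ← one_div]
        exact one_div_le_one_div_of_le (by norm_num) h

lemma card_lt_add_card_ge {ι : Type*} [Fintype ι] [DecidableEq ι] (a : ι → ℝ) (c : ℝ) :
    #{ε : ι → Bool | |rademacherSum a ε| < c} + #{ε : ι → Bool | c ≤ |rademacherSum a ε|} =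
      2 ^ Fintype.card ι := by
  have h := Finset.card_filter_add_card_filter_not (s := (univ : Finset (ι → Bool)))
    (fun ε => |rademacherSum a ε| < c)
  simpa [not_lt] using h

lemma card_lt_le_card_ge_of_weight {ι : Type*} [Fintype ι] [DecidableEq ι] (a : ι → ℝ) {c : ℝ}
    {i : ι} (hi : c ≤ |a i|) :
    #{ε : ι → Bool | |rademacherSum a ε| < c} ≤
      #{ε : ι → Bool | c ≤ |rademacherSum a ε|} := by
  refine Finset.card_le_card_of_injOn (fun ε => Function.update ε i (!ε i)) ?_ ?_
  · intro ε hε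
    rw [mem_coe, mem_filter_univ] at hε ⊢
    have h := congrArg abs (rademacherSum_sub_update a ε i)
    have habs : |2 * a i * (if ε i then (1 : ℝ) else -1)| = 2 * |a i| := by
      cases ε i <;> simp [abs_mul]
    rw [habs] at h
    have := abs_sub (rademacherSum a ε) (rademacherSum a (Function.update ε i (!ε i)))
    linarith
  · refine Function.Injective.injOn (Function.LeftInverse.injective
      (g := fun ε => Function.update ε i (!ε i)) fun ε => ?_)
    simp

lemma card_lt_le_of_small_weights {ι : Type*} [Fintype ι] [DecidableEq ι] (a : ι → ℝ) {c : ℝ}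
    (hc : 29 * c ^ 2 ≤ ∑ i, a i ^ 2) (hpos : 0 < ∑ i, a i ^ 2) (hsmall : ∀ i, |a i| < c) :
    16 * (#{ε : ι → Bool | |rademacherSum a ε| < c} : ℝ) ≤ 9 * 2 ^ Fintype.card ι := by
  set V := ∑ i, a i ^ 2 with hV
  set θ := 3 / √V with hθ
  have hθV : θ ^ 2 * V = 9 := by
    rw [hθ, div_pow, Real.sq_sqrt hpos.le]
    field_simp
    norm_num
  have hθc : θ ^ 2 * c ^ 2 ≤ 9 / 29 := by
    nlinarith [mul_le_mul_of_nonneg_left hc (sq_nonneg θ)]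
  have hsq : ∀ y : ℝ, |y| < c → (θ * y) ^ 2 ≤ 9 / 29 := fun y hy => by
    have hy2 : y ^ 2 ≤ c ^ 2 := sq_le_sq' (by linarith [(abs_lt.1 hy).1]) (abs_lt.1 hy).2.le
    rw [mul_pow]
    nlinarith [mul_le_mul_of_nonneg_left hy2 (sq_nonneg θ)]
  have hprod := prod_cos_le a θ (fun i => (hsq _ (hsmall i)).trans (by norm_num)) hθV
  have hmarkov : (#{ε : ι → Bool | |rademacherSum a ε| < c} : ℝ) * (2 - 9 / 58) ≤
      ∑ ε : ι → Bool, (1 + Real.cos (θ * rademacherSum a ε)) := by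
    rw [← nsmul_eq_mul]
    refine (Finset.card_nsmul_le_sum _ _ _ fun ε hε => ?_).trans
      (Finset.sum_le_sum_of_subset_of_nonneg (Finset.filter_subset _ _) fun ε _ _ => ?_)
    · have := hsq _ (Finset.mem_filter.1 hε).2
      linarith [Real.one_sub_sq_div_two_le_cos (x := θ * rademacherSum a ε)]
    · linarith [Real.neg_one_le_cos (θ * rademacherSum a ε)]
  rw [Finset.sum_add_distrib, sum_cos_rademacherSum] at hmarkov
  have hone : ∑ _ε : ι → Bool, (1 : ℝ) = 2 ^ Fintype.card ι := by simp
  rw [hone] at hmarkov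
  have hN : (0 : ℝ) < 2 ^ Fintype.card ι := by positivity
  nlinarith [mul_le_mul_of_nonneg_left hprod hN.le]

/-- A Rademacher sum exceeds `1 / √29` standard deviations in absolute value with probability
at least `7 / 16`. -/
lemma seven_mul_le_card_abs_ge {ι : Type*} [Fintype ι] [DecidableEq ι] (a : ι → ℝ) {c : ℝ}
    (hc : 29 * c ^ 2 ≤ ∑ i, a i ^ 2) :
    7 * (2 : ℝ) ^ Fintype.card ι ≤ 16 * #{ε : ι → Bool | c ≤ |rademacherSum a ε|} := by
  have htot : (#{ε : ι → Bool | |rademacherSum a ε| < c} : ℝ) +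
      #{ε : ι → Bool | c ≤ |rademacherSum a ε|} = 2 ^ Fintype.card ι := by
    exact_mod_cast card_lt_add_card_ge a c
  have hN : (0 : ℝ) < 2 ^ Fintype.card ι := by positivity
  by_cases hbig : ∃ i, c ≤ |a i|
  · obtain ⟨i, hi⟩ := hbig
    have h : (#{ε : ι → Bool | |rademacherSum a ε| < c} : ℝ) ≤
        #{ε : ι → Bool | c ≤ |rademacherSum a ε|} := by
      exact_mod_cast card_lt_le_card_ge_of_weight a hi
    linarith
  · push Not at hbig
    rcases (Finset.sum_nonneg fun i _ => sq_nonneg (a i) :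
      0 ≤ ∑ i, a i ^ 2).eq_or_lt with h0 | hpos
    · have hc0 : c = 0 := by
        have : c ^ 2 = 0 := le_antisymm (by linarith) (sq_nonneg c)
        simpa using this
      have hempty : #{ε : ι → Bool | |rademacherSum a ε| < c} = 0 := by
        rw [hc0, Finset.card_eq_zero, Finset.filter_eq_empty_iff]
        exact fun ε _ => not_lt.2 (abs_nonneg _)
      rw [hempty, Nat.cast_zero] at htot
      linarith
    · linarith [card_lt_le_of_small_weights a hc hpos hbig]

lemma card_abs_ge_le_two_mul {ι : Type*} [Fintype ι] [DecidableEq ι] (a : ι → ℝ) (c : ℝ) :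
    #{ε : ι → Bool | c ≤ |rademacherSum a ε|} ≤
      2 * #{ε : ι → Bool | c ≤ rademacherSum a ε} := by
  have hneg : #{ε : ι → Bool | c ≤ -rademacherSum a ε} ≤
      #{ε : ι → Bool | c ≤ rademacherSum a ε} := by
    refine Finset.card_le_card_of_injOn (fun ε i => !ε i) ?_ ?_
    · intro ε hε
      simpa [rademacherSum_not] using hε
    · refine Function.Injective.injOn (Function.LeftInverse.injective
        (g := fun ε i => !ε i) fun ε => ?_)
      simp
  have hunion : #{ε : ι → Bool | c ≤ |rademacherSum a ε|} ≤
      #{ε : ι → Bool | c ≤ rademacherSum a ε} + #{ε : ι → Bool | c ≤ -rademacherSum a ε} := by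
    refine le_trans (Finset.card_le_card fun ε hε => ?_) (Finset.card_union_le _ _)
    simpa [le_abs] using hε
  omega

lemma card_tail_le {m : ℕ} (a : Fin (m + 1) → ℝ) (t : ℝ) :
    #{ε : Fin m → Bool | t - a 0 ≤ rademacherSum (fun i => a i.succ) ε} ≤
      #{ε : Fin (m + 1) → Bool | t ≤ rademacherSum a ε} := by
  refine Finset.card_le_card_of_injOn (fun ε => (Fin.cons true ε : Fin (m + 1) → Bool)) ?_
    (Fin.cons_right_injective (α := fun _ => Bool) true).injOn
  intro ε hε
  rw [mem_coe, mem_filter_univ] at hε ⊢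
  unfold rademacherSum at hε ⊢
  rw [Fin.sum_univ_succ]
  simp only [Fin.cons_zero, Fin.cons_succ, if_true, mul_one]
  linarith

/-- **Proposition (`a_1 ≥ 14/15` implies `Pr[X ≥ 1] ≥ 7/64`).**
Let `a_1 ≥ ... ≥ a_n > 0` (0-indexed below) with `Σ a_i² = 1` and `a_1 ≥ 14/15`, and let
`X = Σ a_i ε_i` be the corresponding Rademacher sum (uniform measure on sign vectors
`Fin n → Bool`). Then `Pr[X ≥ 1] ≥ 7/64`. -/
theorem first_weight_large_implies_prob_ge_seven_div_sixtyfour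
    (n : ℕ) (hn : 0 < n) (a : Fin n → ℝ)
    (hpos : ∀ i, 0 < a i)
    (hmono : ∀ i j : Fin n, i ≤ j → a j ≤ a i)
    (hsum : ∑ i, a i ^ 2 = 1)
    (h1 : (14 : ℝ) / 15 ≤ a ⟨0, hn⟩) :
    (7 : ℝ) / 64 ≤
      ((Finset.univ.filter (fun ε : Fin n → Bool =>
          1 ≤ ∑ i, a i * (if ε i then (1 : ℝ) else -1))).card : ℝ) / 2 ^ n := by
  obtain ⟨m, rfl⟩ : ∃ m, n = m + 1 := ⟨n - 1, by omega⟩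
  change (14 : ℝ) / 15 ≤ a 0 at h1
  rw [Fin.sum_univ_succ] at hsum
  have htail : 29 * (1 - a 0) ^ 2 ≤ ∑ i : Fin m, a i.succ ^ 2 := by
    have hnn : 0 ≤ ∑ i : Fin m, a i.succ ^ 2 := Finset.sum_nonneg fun i _ => sq_nonneg _
    have ha1 : a 0 ≤ 1 := by nlinarith
    nlinarith
  have habs := seven_mul_le_card_abs_ge (fun i : Fin m => a i.succ) htail
  have hcard : (#{ε : Fin m → Bool | 1 - a 0 ≤ |rademacherSum (fun i => a i.succ) ε|} : ℝ) ≤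
      2 * #{ε : Fin (m + 1) → Bool | 1 ≤ rademacherSum a ε} := by
    exact_mod_cast (card_abs_ge_le_two_mul _ _).trans
      (Nat.mul_le_mul_left 2 (card_tail_le a 1))
  rw [Fintype.card_fin] at habs
  change _ ≤ (#{ε : Fin (m + 1) → Bool | 1 ≤ rademacherSum a ε} : ℝ) / 2 ^ (m + 1)
  rw [le_div_iff₀ (by positivity), pow_succ]
  linarith
end

section
/- Let 0 < δ ≤ 10^{-9}, let b_1 ≥ b_2 ≥ ... ≥ b_m > 0 be real numbers with Σ_{i=1}^m b_i^2 = 1 and b_1 ≤ 1/2 + 10^{-5}, and let S = Σ_{i=1}^m b_i ε_i be the corresponding Rademacher sum. Then Pr[|S| ≥ 4δ] ≥ 5/8. -/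
open Finset

/-- The sum of cosines of a Rademacher sum factors as a product of cosines. -/
lemma sum_cos_rademacher {m : ℕ} (b : Fin m → ℝ) (t : ℝ) :
    ∑ ε : Fin m → Bool, Real.cos (t * ∑ i, b i * (if ε i then (1 : ℝ) else -1)) =
      2 ^ m * ∏ i, Real.cos (t * b i) := by
  have key : ∑ ε : Fin m → Bool,
      Complex.exp (((t * ∑ i, b i * (if ε i then (1 : ℝ) else -1) : ℝ) : ℂ) * Complex.I) =
      ((2 ^ m * ∏ i, Real.cos (t * b i) : ℝ) : ℂ) := by
    have h := Finset.prod_univ_sum (fun _ : Fin m => (Finset.univ : Finset Bool))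
      (fun i e => Complex.exp (((t * (b i * (if e then (1 : ℝ) else -1)) : ℝ) : ℂ) * Complex.I))
    rw [Fintype.piFinset_univ] at h
    have hl : ∀ i : Fin m, ∑ e : Bool,
        Complex.exp (((t * (b i * (if e then (1 : ℝ) else -1)) : ℝ) : ℂ) * Complex.I) =
        2 * ((Real.cos (t * b i) : ℝ) : ℂ) := by
      intro i
      rw [Fintype.sum_bool, Complex.ofReal_cos, Complex.two_cos]
      simp
    simp only [hl, Finset.prod_mul_distrib, Finset.prod_const, Finset.card_univ,
      Fintype.card_fin] at h
    push_cast at h ⊢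
    rw [h]
    refine Finset.sum_congr rfl fun ε _ => ?_
    rw [← Complex.exp_sum, Finset.mul_sum, Finset.sum_mul]
  have hre := congrArg Complex.re key
  rw [Complex.re_sum, Complex.ofReal_re] at hre
  simpa only [Complex.exp_ofReal_mul_I_re] using hre

/-- Among the eight signed sums of three numbers that are at least `r`, at most three lie in a
given open interval of length `2 * r`. -/
lemma card_three_signs_le {r x y z : ℝ} (hx : r ≤ x) (hy : r ≤ y) (hz : r ≤ z) (hr : 0 < r)
    (c : ℝ) :
    ∑ e : Bool, ∑ f : Bool, ∑ g : Bool,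
      (if |x * (if e then (1 : ℝ) else -1) + (y * (if f then (1 : ℝ) else -1) +
        (z * (if g then (1 : ℝ) else -1) + c))| < r then (1 : ℝ) else 0) ≤ 3 := by
  have chain : ∀ {u v : ℝ}, u + 2 * r ≤ v →
      (if |u| < r then (1 : ℝ) else 0) + (if |v| < r then (1 : ℝ) else 0) ≤ 1 := by
    intro u v huv
    split_ifs with h1 h2 <;> norm_num
    rw [abs_lt] at h1 h2
    linarith
  have chain₄ : ∀ {u v w s : ℝ}, u + 2 * r ≤ v → v + 2 * r ≤ w → w + 2 * r ≤ s →
      (if |u| < r then (1 : ℝ) else 0) + (if |v| < r then (1 : ℝ) else 0) +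
      (if |w| < r then (1 : ℝ) else 0) + (if |s| < r then (1 : ℝ) else 0) ≤ 1 := by
    intro u v w s h1 h2 h3
    split_ifs with a1 a2 a3 a4 a4 a3 a4 a4 a2 a3 a4 a4 a3 a4 a4 <;> norm_num <;>
      simp only [abs_lt] at * <;> linarith
  simp only [Fintype.sum_bool, if_true, Bool.false_eq_true, if_false]
  have c1 := chain₄ (u := x * -1 + (y * -1 + (z * -1 + c))) (v := x * 1 + (y * -1 + (z * -1 + c)))
    (w := x * 1 + (y * 1 + (z * -1 + c))) (s := x * 1 + (y * 1 + (z * 1 + c)))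
    (by linarith) (by linarith) (by linarith)
  have c2 := chain (u := x * -1 + (y * -1 + (z * 1 + c))) (v := x * 1 + (y * -1 + (z * 1 + c)))
    (by linarith)
  have c3 := chain (u := x * -1 + (y * 1 + (z * -1 + c))) (v := x * -1 + (y * 1 + (z * 1 + c)))
    (by linarith)
  linarith

/-- Sums over sign vectors split off the first sign. -/
lemma sum_fin_succ_bool {n : ℕ} (f : (Fin (n + 1) → Bool) → ℝ) :
    ∑ ε, f ε = ∑ e : Bool, ∑ ε : Fin n → Bool, f (Fin.cons e ε) := by
  rw [← Fintype.sum_prod_type' (fun e (ε : Fin n → Bool) => f (Fin.cons e ε))]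
  exact (Fintype.sum_equiv (Fin.consEquiv fun _ : Fin (n + 1) => Bool) _ _ fun _ => rfl).symm

/-- Littlewood–Offord for three large weights. -/
lemma card_abs_lt_le_of_three_large {n : ℕ} (b : Fin (n + 3) → ℝ) {r : ℝ} (hr : 0 < r)
    (h0 : r ≤ b 0) (h1 : r ≤ b 1) (h2 : r ≤ b 2) :
    (∑ ε : Fin (n + 3) → Bool,
      if |∑ i, b i * (if ε i then (1 : ℝ) else -1)| < r then (1 : ℝ) else 0) ≤
      3 / 8 * 2 ^ (n + 3) := by
  simp only [sum_fin_succ_bool, Fin.sum_univ_succ, Fin.cons_zero, Fin.cons_succ]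
  have hswap : ∀ F : Bool → Bool → Bool → (Fin n → Bool) → ℝ,
      ∑ e, ∑ f, ∑ g, ∑ ε, F e f g ε = ∑ ε, ∑ e, ∑ f, ∑ g, F e f g ε := by
    intro F
    simp only [Fintype.sum_bool, Finset.sum_add_distrib]
  rw [hswap]
  calc _ ≤ ∑ _ε : Fin n → Bool, (3 : ℝ) :=
        Finset.sum_le_sum fun ε _ => card_three_signs_le h0 h1 h2 hr _
    _ = _ := by
        simp
        ring

lemma abs_cos_le_exp {x : ℝ} (hx : |x| ≤ 1) : |Real.cos x| ≤ Real.exp (-(1 / 5) * x ^ 2) := by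
  have hπ : |x| ≤ Real.pi := hx.trans (by linarith [Real.pi_gt_three])
  have hnn : 0 ≤ Real.cos x := Real.cos_nonneg_of_mem_Icc
    ⟨by linarith [(abs_le.mp hx).1, Real.pi_gt_three],
      by linarith [(abs_le.mp hx).2, Real.pi_gt_three]⟩
  rw [abs_of_nonneg hnn]
  have hc : (1 / 5 : ℝ) ≤ 2 / Real.pi ^ 2 := by
    rw [div_le_div_iff₀ (by norm_num) (by positivity)]
    nlinarith [Real.pi_lt_d2, Real.pi_gt_three]
  have h := Real.cos_le_one_sub_mul_cos_sq hπ
  have h' := Real.add_one_le_exp (-(1 / 5) * x ^ 2)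
  nlinarith [mul_le_mul_of_nonneg_right hc (sq_nonneg x)]

/-- A product of cosines is small as soon as all but two angles are small but together carry
substantial mass. -/
lemma prod_cos_le_s17 {n : ℕ} (b : Fin (n + 2) → ℝ) {t : ℝ}
    (hsmall : ∀ i : Fin n, |t * b i.succ.succ| ≤ 1)
    (hmass : 200 ≤ t ^ 2 * ∑ i : Fin n, b i.succ.succ ^ 2) :
    ∏ i, Real.cos (t * b i) ≤ 1 / 40 := by
  have hexp : (∏ i : Fin n, |Real.cos (t * b i.succ.succ)|) ≤ 1 / 40 := by
    calc (∏ i : Fin n, |Real.cos (t * b i.succ.succ)|)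
        ≤ ∏ i : Fin n, Real.exp (-(1 / 5) * (t * b i.succ.succ) ^ 2) :=
          Finset.prod_le_prod (fun _ _ => abs_nonneg _) fun i _ => abs_cos_le_exp (hsmall i)
      _ = Real.exp (-(1 / 5 * (t ^ 2 * ∑ i : Fin n, b i.succ.succ ^ 2))) := by
          rw [← Real.exp_sum, ← Finset.mul_sum]
          simp only [mul_pow, ← Finset.mul_sum]
          ring_nf
      _ ≤ Real.exp (-40) := Real.exp_le_exp.mpr (by linarith)
      _ ≤ 1 / 40 := by
          rw [Real.exp_neg, ← one_div]
          exact one_div_le_one_div_of_le (by norm_num) (by linarith [Real.add_one_le_exp (40 : ℝ)])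
  have hnn : 0 ≤ ∏ i : Fin n, |Real.cos (t * b i.succ.succ)| :=
    Finset.prod_nonneg fun _ _ => abs_nonneg _
  refine (le_abs_self _).trans ?_
  rw [Finset.abs_prod, Fin.prod_univ_succ, Fin.prod_univ_succ]
  refine (mul_le_of_le_one_left (mul_nonneg (abs_nonneg _) hnn) (Real.abs_cos_le_one _)).trans ?_
  exact (mul_le_of_le_one_left hnn (Real.abs_cos_le_one _)).trans hexp

/-- Small-ball estimate when all but two weights are tiny, by comparing the indicator function with
the trigonometric polynomial `((1 + cos x) / 2) ^ 3`. -/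
lemma card_abs_lt_le_of_tail_small {n : ℕ} (b : Fin (n + 2) → ℝ) {r : ℝ} (hr : r ≤ 1 / 1000)
    (hsmall : ∀ i : Fin n, |b i.succ.succ| ≤ r)
    (hmass : 1 / 2 - 1 / 1000 ≤ ∑ i : Fin n, b i.succ.succ ^ 2) :
    (∑ ε : Fin (n + 2) → Bool,
      if |∑ i, b i * (if ε i then (1 : ℝ) else -1)| < r then (1 : ℝ) else 0) ≤
      3 / 8 * 2 ^ (n + 2) := by
  have hpt : ∀ s : ℝ, (if |s| < r then (1 : ℝ) else 0) ≤
      100 / 99 / 32 * (10 + 15 * Real.cos (21 * s) + 6 * Real.cos (42 * s) +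
        Real.cos (63 * s)) := by
    intro s
    have e2 : Real.cos (42 * s) = 2 * Real.cos (21 * s) ^ 2 - 1 := by
      rw [← Real.cos_two_mul]; ring_nf
    have e3 : Real.cos (63 * s) = 4 * Real.cos (21 * s) ^ 3 - 3 * Real.cos (21 * s) := by
      rw [← Real.cos_three_mul]; ring_nf
    have e : 10 + 15 * Real.cos (21 * s) + 6 * Real.cos (42 * s) + Real.cos (63 * s) =
        4 * (1 + Real.cos (21 * s)) ^ 3 := by
      rw [e2, e3]; ring
    rw [e]
    split_ifs with hs
    · have hs' := abs_lt.mp (hs.trans_le hr)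
      have hc := Real.one_sub_sq_div_two_le_cos (x := 21 * s)
      have hs2 : s ^ 2 ≤ 1 / 1000000 := by nlinarith
      have hc' : (1.999 : ℝ) ≤ 1 + Real.cos (21 * s) := by nlinarith
      have := pow_le_pow_left₀ (by norm_num) hc' 3
      norm_num at this ⊢
      linarith
    · have hc : 0 ≤ 1 + Real.cos (21 * s) := by linarith [Real.neg_one_le_cos (21 * s)]
      positivity
  have hprod : ∀ t : ℝ, 21 ≤ t → t ≤ 63 → ∏ i, Real.cos (t * b i) ≤ 1 / 40 := by
    intro t ht ht'
    refine prod_cos_le_s17 b (fun i => ?_) ?_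
    · rw [abs_mul, abs_of_nonneg (by linarith)]
      nlinarith [hsmall i, abs_nonneg (b i.succ.succ)]
    · nlinarith [pow_le_pow_left₀ (by norm_num) ht 2]
  refine (Finset.sum_le_sum fun ε _ => hpt _).trans ?_
  rw [← Finset.mul_sum]
  simp only [Finset.sum_add_distrib, ← Finset.mul_sum, sum_cos_rademacher]
  simp only [Finset.sum_const, Finset.card_univ, Fintype.card_fun, Fintype.card_bool,
    Fintype.card_fin, nsmul_eq_mul]
  push_cast
  have h2 : (0 : ℝ) < 2 ^ (n + 2) := by positivity
  have p1 := mul_le_mul_of_nonneg_left (hprod 21 (by norm_num) (by norm_num)) h2.le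
  have p2 := mul_le_mul_of_nonneg_left (hprod 42 (by norm_num) (by norm_num)) h2.le
  have p3 := mul_le_mul_of_nonneg_left (hprod 63 (by norm_num) (by norm_num)) h2.le
  linarith

/-- **Lemma (anti-concentration near 0 for balanced weights).**
Let `0 < δ ≤ 10⁻⁹` and let `b_1 ≥ ... ≥ b_m > 0` (0-indexed below) with `Σ b_i² = 1` and
`b_1 ≤ 1/2 + 10⁻⁵`. Then the Rademacher sum `S = Σ b_i ε_i` (uniform measure on sign
vectors `Fin m → Bool`) satisfies `Pr[|S| ≥ 4δ] ≥ 5/8`. -/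
theorem balanced_weights_abs_ge_four_delta
    (m : ℕ) (hm : 0 < m) (δ : ℝ) (hδ0 : 0 < δ) (hδ : δ ≤ 10 ^ (-(9 : ℤ)))
    (b : Fin m → ℝ)
    (hpos : ∀ i, 0 < b i)
    (hmono : ∀ i j : Fin m, i ≤ j → b j ≤ b i)
    (hsum : ∑ i, b i ^ 2 = 1)
    (h1 : b ⟨0, hm⟩ ≤ 1 / 2 + 10 ^ (-(5 : ℤ))) :
    (5 : ℝ) / 8 ≤
      ((Finset.univ.filter (fun ε : Fin m → Bool =>
          4 * δ ≤ |∑ i, b i * (if ε i then (1 : ℝ) else -1)|)).card : ℝ) / 2 ^ m := by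
  have hδ' : δ ≤ 1 / 1000000000 := by norm_num at hδ; exact hδ
  have hb : ∀ i, b i ^ 2 ≤ 1 / 4 + 1 / 10000 := by
    intro i
    have hi := (hmono ⟨0, hm⟩ i (Nat.zero_le _)).trans h1
    norm_num at hi
    nlinarith [hpos i]
  suffices hle : (∑ ε : Fin m → Bool,
      if |∑ i, b i * (if ε i then (1 : ℝ) else -1)| < 4 * δ then (1 : ℝ) else 0) ≤
      3 / 8 * 2 ^ m by
    have hcompl := Finset.card_filter_add_card_filter_not
      (s := (Finset.univ : Finset (Fin m → Bool)))
      (fun ε => 4 * δ ≤ |∑ i, b i * (if ε i then (1 : ℝ) else -1)|)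
    simp only [not_le, Finset.card_univ, Fintype.card_fun, Fintype.card_bool,
      Fintype.card_fin] at hcompl
    have hcompl' := congrArg (Nat.cast : ℕ → ℝ) hcompl
    push_cast at hcompl'
    rw [Finset.sum_boole] at hle
    rw [le_div_iff₀ (by positivity)]
    linarith
  match m, hm with
  | 1, _ =>
    rw [Fin.sum_univ_one] at hsum
    linarith [hb 0]
  | 2, _ =>
    rw [Fin.sum_univ_two] at hsum
    linarith [hb 0, hb 1]
  | n + 3, _ =>
    by_cases h : 4 * δ ≤ b 2
    · have h21 : b 2 ≤ b 1 := hmono 1 2 (Fin.mk_le_mk.mpr (by simp [Nat.mod_eq_of_lt]))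
      have h10 : b 1 ≤ b 0 := hmono 0 1 (Fin.zero_le _)
      exact card_abs_lt_le_of_three_large b (by linarith) (by linarith) (by linarith) h
    · refine card_abs_lt_le_of_tail_small (n := n + 1) b (by linarith) (fun i => ?_) ?_
      · rw [abs_of_pos (hpos _)]
        have : b i.succ.succ ≤ b 2 := hmono 2 _ (by
          rw [Fin.le_def, Fin.val_two]
          simp)
        linarith
      · rw [Fin.sum_univ_succ, Fin.sum_univ_succ] at hsum
        linarith [hb 0, hb (Fin.succ 0)]
end

section
/- Let 0 < δ ≤ 10^{-9}, let b_1 ≥ b_2 ≥ ... ≥ b_m > 0 be real numbers with Σ_{i=1}^m b_i^2 = 1 and b_1 ≤ 1/2 + 10^{-5}, and let S = Σ_{i=1}^m b_i ε_i be the corresponding Rademacher sum. Then Pr[|S| ≥ 1 + 4δ] ≥ 1/8. -/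
open Finset

/-- The Rademacher sum `∑ bᵢ εᵢ` evaluated at the sign vector `ε`. -/
noncomputable def signSum {ι : Type*} [Fintype ι] (b : ι → ℝ) (ε : ι → Bool) : ℝ :=
  ∑ i, b i * (if ε i then (1 : ℝ) else -1)

theorem sum_cos_signSum {ι : Type*} [Fintype ι] [DecidableEq ι] (b : ι → ℝ) (t : ℝ) :
    ∑ ε : ι → Bool, Real.cos (t * signSum b ε) =
      2 ^ Fintype.card ι * ∏ i, Real.cos (t * b i) := by
  have h : ∑ ε : ι → Bool, Complex.exp ((t * signSum b ε : ℝ) * Complex.I) =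
      ((2 ^ Fintype.card ι * ∏ i, Real.cos (t * b i) : ℝ) : ℂ) := by
    have hfac (i : ι) : ∑ e : Bool,
        Complex.exp ((t * (b i * (if e then (1 : ℝ) else -1)) : ℝ) * Complex.I) =
          2 * Complex.cos (t * b i : ℝ) := by
      rw [Complex.two_cos]
      simp
    calc
      _ = ∑ ε : ι → Bool, ∏ i,
          Complex.exp ((t * (b i * (if ε i then (1 : ℝ) else -1)) : ℝ) * Complex.I) := by
        refine sum_congr rfl fun ε _ => ?_
        rw [← Complex.exp_sum, ← sum_mul, ← Complex.ofReal_sum, ← mul_sum, signSum]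
      _ = ∏ i, ∑ e : Bool,
          Complex.exp ((t * (b i * (if e then (1 : ℝ) else -1)) : ℝ) * Complex.I) := by
        rw [prod_univ_sum, Fintype.piFinset_univ]
      _ = _ := by
        simp_rw [hfac, prod_mul_distrib, prod_const, card_univ]
        push_cast
        rfl
  have hre := congrArg Complex.re h
  rw [Complex.re_sum, Complex.ofReal_re] at hre
  simpa only [Complex.exp_ofReal_mul_I_re] using hre

theorem abs_cos_le_exp_neg_sq_div_two {x : ℝ} (h0 : 0 ≤ x) (hx : x ≤ 1.72) :
    |Real.cos x| ≤ Real.exp (-(x ^ 2 / 2)) := by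
  rw [abs_le']
  constructor
  · obtain rfl | hpos := h0.eq_or_lt
    · simp
    have hsin : x / 2 - (x / 2) ^ 3 / 6 ≤ Real.sin (x / 2) :=
      (Real.sin_gt_sub_cube (by linarith)).le
    have hu : 0 ≤ x / 2 - (x / 2) ^ 3 / 6 := by nlinarith [mul_pos hpos hpos]
    have hcos : Real.cos x = 1 - 2 * Real.sin (x / 2) ^ 2 := by
      have := Real.cos_two_mul (x / 2)
      rw [mul_div_cancel₀ x two_ne_zero] at this
      linarith [Real.sin_sq_add_cos_sq (x / 2)]
    have hsq := pow_le_pow_left₀ hu hsin 2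
    have hexp : 1 - x ^ 2 / 4 ≤ Real.exp (-(x ^ 2 / 4)) := by
      linarith [Real.add_one_le_exp (-(x ^ 2 / 4))]
    have hexp2 := pow_le_pow_left₀ (by nlinarith) hexp 2
    rw [← Real.exp_nat_mul] at hexp2
    have he : ((2 : ℕ) : ℝ) * -(x ^ 2 / 4) = -(x ^ 2 / 2) := by push_cast; ring
    rw [he] at hexp2
    nlinarith [sq_nonneg (x ^ 3)]
  · have hpi := Real.pi_gt_d6
    have hexp : (0.15 : ℝ) ≤ Real.exp (-(x ^ 2 / 2)) := by
      have h1 : Real.exp (-1 + -0.48) ≤ Real.exp (-(x ^ 2 / 2)) :=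
        Real.exp_le_exp.2 (by nlinarith)
      rw [Real.exp_add] at h1
      have h2 := Real.exp_neg_one_gt_d9
      have h3 := Real.add_one_le_exp (-0.48 : ℝ)
      nlinarith
    by_cases hc : x ≤ Real.pi / 2
    · have := Real.cos_nonneg_of_neg_pi_div_two_le_of_le (by linarith) hc
      linarith
    · have hs : -Real.cos x = Real.sin (x - Real.pi / 2) := by
        rw [Real.sin_sub_pi_div_two]
      rw [hs]
      have := Real.sin_le (x := x - Real.pi / 2) (by linarith)
      linarith

theorem abs_prod_cos_le_exp {ι : Type*} [Fintype ι] (b : ι → ℝ) (t v : ℝ) (s : Finset ι)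
    (hb : ∀ i ∈ s, 0 ≤ t * b i) (hbt : ∀ i ∈ s, t * b i ≤ 1.72) (hv : v ≤ ∑ i ∈ s, b i ^ 2) :
    |∏ i, Real.cos (t * b i)| ≤ Real.exp (-(t ^ 2 / 2 * v)) := by
  classical
  calc
    |∏ i, Real.cos (t * b i)| = ∏ i, |Real.cos (t * b i)| := abs_prod _ _
    _ ≤ ∏ i ∈ s, |Real.cos (t * b i)| := by
      rw [← prod_mul_prod_compl s]
      exact mul_le_of_le_one_right (prod_nonneg fun _ _ => abs_nonneg _)
        (prod_le_one (fun _ _ => abs_nonneg _) fun _ _ => Real.abs_cos_le_one _)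
    _ ≤ ∏ i ∈ s, Real.exp (-((t * b i) ^ 2 / 2)) :=
      prod_le_prod (fun _ _ => abs_nonneg _) fun i hi =>
        abs_cos_le_exp_neg_sq_div_two (hb i hi) (hbt i hi)
    _ = Real.exp (-(t ^ 2 / 2 * ∑ i ∈ s, b i ^ 2)) := by
      rw [← Real.exp_sum, mul_sum, ← sum_neg_distrib]
      congr 1
      exact sum_congr rfl fun i _ => by ring
    _ ≤ _ := Real.exp_le_exp.2 (by nlinarith [sq_nonneg t])

/-- If three of the weights have sum at least `θ`, then `|S| ≥ θ` with probability at
least `1 / 8`: among the eight sign vectors obtained by flipping the first sign, the second sign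
and all signs outside the triple, at least one is good. -/
theorem two_pow_le_eight_mul_card_of_add_add_ge {ι : Type*} [Fintype ι] [DecidableEq ι]
    (b : ι → ℝ) {θ : ℝ} {i j k : ι} (hij : i ≠ j) (hik : i ≠ k) (hjk : j ≠ k)
    (h : θ ≤ b i + b j + b k) :
    2 ^ Fintype.card ι ≤
      8 * (univ.filter fun ε : ι → Bool => θ ≤ |signSum b ε|).card := by
  let flip : Bool × Bool × Bool → (ι → Bool) → (ι → Bool) := fun g ε l =>
    xor (ε l) (if l = i then g.1 else if l = j then g.2.1 else if l = k then false else g.2.2)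
  have hflip (g) : Function.Involutive (flip g) := fun ε => by
    funext l
    simp [flip]
  have hgood (ε : ι → Bool) : ∃ g, θ ≤ |signSum b (flip g ε)| := by
    by_contra! hlt
    have h0 := hlt (xor (ε i) (ε k), xor (ε j) (ε k), false)
    have h1 := hlt (xor (ε i) (ε k), xor (ε j) (ε k), true)
    set ε₀ := flip (xor (ε i) (ε k), xor (ε j) (ε k), false) ε
    set ε₁ := flip (xor (ε i) (ε k), xor (ε j) (ε k), true) ε
    set s : ℝ := if ε k then 1 else -1 with hs
    have hadd : signSum b ε₀ + signSum b ε₁ = 2 * s * (b i + b j + b k) := by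
      have hterm (l : ι) : b l * (if ε₀ l then (1 : ℝ) else -1) +
          b l * (if ε₁ l then (1 : ℝ) else -1) =
            (if l = i then 2 * s * b i else 0) + (if l = j then 2 * s * b j else 0) +
              (if l = k then 2 * s * b k else 0) := by
        by_cases hli : l = i
        · subst hli
          simp only [ε₀, ε₁, flip, s, hij, hik, if_true, if_false]
          cases ε l <;> cases ε k <;> norm_num <;> ring
        by_cases hlj : l = j
        · subst hlj
          simp only [ε₀, ε₁, flip, s, hli, hjk, if_true, if_false]
          cases ε l <;> cases ε k <;> norm_num <;> ring
        by_cases hlk : l = k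
        · subst hlk
          simp only [ε₀, ε₁, flip, s, hli, hlj, if_true, if_false]
          cases ε l <;> norm_num <;> ring
        · simp only [ε₀, ε₁, flip, hli, hlj, hlk, if_false]
          cases ε l <;> norm_num
      rw [signSum, signSum, ← sum_add_distrib, sum_congr rfl fun l _ => hterm l]
      simp only [sum_add_distrib, sum_ite_eq', mem_univ, if_true]
      ring
    obtain ⟨h0l, h0u⟩ := abs_lt.1 h0
    obtain ⟨h1l, h1u⟩ := abs_lt.1 h1
    rcases Bool.eq_false_or_eq_true (ε k) with hk | hk <;>
      · simp only [hk] at hs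
        norm_num at hs
        rw [hs] at hadd
        linarith
  have hcover : (univ : Finset (ι → Bool)) ⊆ univ.biUnion fun g =>
      (univ.filter fun ε : ι → Bool => θ ≤ |signSum b ε|).image (flip g) := by
    intro ε _
    obtain ⟨g, hg⟩ := hgood ε
    exact mem_biUnion.2 ⟨g, mem_univ _, mem_image.2 ⟨flip g ε, by simpa using hg, hflip g ε⟩⟩
  calc
    2 ^ Fintype.card ι = (univ : Finset (ι → Bool)).card := by simp
    _ ≤ _ := card_le_card hcover
    _ ≤ (univ : Finset (Bool × Bool × Bool)).card * _ :=
      card_biUnion_le_card_mul _ _ _ fun g _ => card_image_le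
    _ = _ := by simp

/-- A trigonometric minorant, of period `2π / 1.7`, of the indicator of `|s| ≥ θ`. -/
theorem trig_minorant_le_indicator {θ s : ℝ} (hθ : θ ≤ 1 + 0.000000004) :
    -0.33 * (Real.cos (1.7 * s) + 0.1294) * (Real.cos (1.7 * s) - 0.86) ^ 2 ≤
      if θ ≤ |s| then 1 else 0 := by
  have h1 := Real.neg_one_le_cos (1.7 * s)
  split_ifs with h
  · set x := Real.cos (1.7 * s)
    by_cases hx : -0.1294 ≤ x
    · nlinarith [mul_nonneg (by linarith : 0 ≤ x + 0.1294) (sq_nonneg (x - 0.86))]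
    · have hsq : (x - 0.86) ^ 2 ≤ 1.86 ^ 2 := by nlinarith
      nlinarith [mul_le_mul_of_nonneg_left hsq (by linarith : 0 ≤ -(x + 0.1294))]
  · have hpi := Real.pi_gt_d6
    have hcos : -0.1294 ≤ Real.cos (1.7 * s) := by
      rw [← Real.cos_abs, abs_mul, abs_of_pos (by norm_num : (0 : ℝ) < 1.7)]
      by_cases hc : 1.7 * |s| ≤ Real.pi / 2
      · have := Real.cos_nonneg_of_neg_pi_div_two_le_of_le
          (by linarith [abs_nonneg s] : -(Real.pi / 2) ≤ 1.7 * |s|) hc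
        linarith
      · have := Real.sin_le (x := 1.7 * |s| - Real.pi / 2) (by linarith)
        rw [Real.sin_sub_pi_div_two] at this
        linarith
    nlinarith [mul_nonneg (by linarith : 0 ≤ Real.cos (1.7 * s) + 0.1294)
      (sq_nonneg (Real.cos (1.7 * s) - 0.86))]

theorem trig_minorant_eq (s : ℝ) :
    -0.33 * (Real.cos (1.7 * s) + 0.1294) * (Real.cos (1.7 * s) - 0.86) ^ 2 =
      0.33 * (0.69959576 - 1.267032 * Real.cos (1.7 * s) + 0.7953 * Real.cos (3.4 * s)
        - 0.25 * Real.cos (5.1 * s)) := by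
  have h2 : Real.cos (3.4 * s) = 2 * Real.cos (1.7 * s) ^ 2 - 1 := by
    rw [← Real.cos_two_mul]; ring_nf
  have h3 : Real.cos (5.1 * s) = 4 * Real.cos (1.7 * s) ^ 3 - 3 * Real.cos (1.7 * s) := by
    rw [← Real.cos_three_mul]; ring_nf
  rw [h2, h3]
  ring

/-- The Fourier-analytic bound: if at most two weights exceed `0.337`, the minorant has mean at
least `1 / 8`. -/
theorem card_ge_of_card_large_le_two {ι : Type*} [Fintype ι] [DecidableEq ι] (b : ι → ℝ)
    {θ : ℝ} (hθ : θ ≤ 1 + 0.000000004) (hpos : ∀ i, 0 ≤ b i) (hle : ∀ i, b i ≤ 0.50001)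
    (hsum : ∑ i, b i ^ 2 = 1) (hcard : (univ.filter fun i => 0.337 < b i).card ≤ 2) :
    2 ^ Fintype.card ι / 8 ≤
      ((univ.filter fun ε : ι → Bool => θ ≤ |signSum b ε|).card : ℝ) := by
  have hsmall : (0.49 : ℝ) ≤ ∑ i ∈ univ.filter (fun i => ¬ 0.337 < b i), b i ^ 2 := by
    have hsplit := sum_filter_add_sum_filter_not univ (fun i => 0.337 < b i) fun i => b i ^ 2
    have hlarge : ∑ i ∈ univ.filter (fun i => 0.337 < b i), b i ^ 2 ≤
        (univ.filter fun i => 0.337 < b i).card • (0.255 : ℝ) :=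
      sum_le_card_nsmul _ _ _ fun i _ => by nlinarith [hpos i, hle i]
    have hc : ((univ.filter fun i => 0.337 < b i).card : ℝ) ≤ 2 := by exact_mod_cast hcard
    rw [nsmul_eq_mul] at hlarge
    linarith
  have hexp1 := Real.exp_neg_one_lt_d9
  have hexp5 : Real.exp (-5) ≤ 0.007 := by
    have h5 : Real.exp (-5) = Real.exp (-1) ^ 5 := by
      rw [← Real.exp_nat_mul]; norm_num
    rw [h5]
    calc
      Real.exp (-1) ^ 5 ≤ 0.37 ^ 5 :=
        pow_le_pow_left₀ (Real.exp_pos _).le (by linarith) 5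
      _ ≤ 0.007 := by norm_num
  have hE1 : ∏ i, Real.cos (1.7 * b i) ≤ 0.24 := by
    refine (le_abs_self _).trans <| (abs_prod_cos_le_exp b 1.7 1 univ
      (fun i _ => by linarith [hpos i]) (fun i _ => by linarith [hle i]) hsum.ge).trans ?_
    have hq := Real.quadratic_le_exp_of_nonneg (x := 0.445) (by norm_num)
    have he : Real.exp (-(1.7 ^ 2 / 2 * 1)) * Real.exp 0.445 = Real.exp (-1) := by
      rw [← Real.exp_add]; norm_num
    nlinarith [Real.exp_pos (-(1.7 ^ 2 / 2 * 1))]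
  have hE2 : -0.007 ≤ ∏ i, Real.cos (3.4 * b i) := by
    refine (abs_le.1 <| (abs_prod_cos_le_exp b 3.4 1 univ
      (fun i _ => by linarith [hpos i]) (fun i _ => by linarith [hle i]) hsum.ge).trans ?_).1
    exact (Real.exp_le_exp.2 (by norm_num)).trans hexp5
  have hE3 : ∏ i, Real.cos (5.1 * b i) ≤ 0.007 := by
    refine (le_abs_self _).trans <| (abs_prod_cos_le_exp b 5.1 0.49 _
      (fun i _ => by linarith [hpos i]) (fun i hi => ?_) hsmall).trans ?_
    · have := not_lt.1 (mem_filter.1 hi).2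
      linarith
    · exact (Real.exp_le_exp.2 (by norm_num)).trans hexp5
  calc
    (2 : ℝ) ^ Fintype.card ι / 8 ≤ ∑ ε : ι → Bool,
        0.33 * (0.69959576 - 1.267032 * Real.cos (1.7 * signSum b ε)
          + 0.7953 * Real.cos (3.4 * signSum b ε) - 0.25 * Real.cos (5.1 * signSum b ε)) := by
      rw [← mul_sum]
      simp only [sum_sub_distrib, sum_add_distrib, ← mul_sum, sum_cos_signSum, sum_const,
        card_univ, Fintype.card_fun, Fintype.card_bool, nsmul_eq_mul]
      push_cast
      have h2 : (0 : ℝ) < 2 ^ Fintype.card ι := by positivity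
      nlinarith
    _ ≤ ∑ ε : ι → Bool, if θ ≤ |signSum b ε| then (1 : ℝ) else 0 :=
      sum_le_sum fun ε _ => (trig_minorant_eq _).symm.trans_le (trig_minorant_le_indicator hθ)
    _ = _ := by simp

/-- **Lemma (tail beyond `1 + 4δ` for balanced weights).**
Let `0 < δ ≤ 10⁻⁹` and let `b_1 ≥ ... ≥ b_m > 0` (0-indexed below) with `Σ b_i² = 1` and
`b_1 ≤ 1/2 + 10⁻⁵`. Then the Rademacher sum `S = Σ b_i ε_i` (uniform measure on sign
vectors `Fin m → Bool`) satisfies `Pr[|S| ≥ 1 + 4δ] ≥ 1/8`. -/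
theorem balanced_weights_abs_ge_one_add_four_delta
    (m : ℕ) (hm : 0 < m) (δ : ℝ) (hδ0 : 0 < δ) (hδ : δ ≤ 10 ^ (-(9 : ℤ)))
    (b : Fin m → ℝ)
    (hpos : ∀ i, 0 < b i)
    (hmono : ∀ i j : Fin m, i ≤ j → b j ≤ b i)
    (hsum : ∑ i, b i ^ 2 = 1)
    (h1 : b ⟨0, hm⟩ ≤ 1 / 2 + 10 ^ (-(5 : ℤ))) :
    (1 : ℝ) / 8 ≤
      ((Finset.univ.filter (fun ε : Fin m → Bool =>
          1 + 4 * δ ≤ |∑ i, b i * (if ε i then (1 : ℝ) else -1)|)).card : ℝ) / 2 ^ m := by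
  have hδ' : 1 + 4 * δ ≤ 1 + 0.000000004 := by norm_num at hδ ⊢; linarith
  have hle (i : Fin m) : b i ≤ 0.50001 :=
    (hmono ⟨0, hm⟩ i (Nat.zero_le _)).trans (h1.trans (by norm_num))
  change (1 : ℝ) / 8 ≤ ((univ.filter fun ε : Fin m → Bool =>
    1 + 4 * δ ≤ |signSum b ε|).card : ℝ) / 2 ^ m
  rw [le_div_iff₀ (by positivity)]
  by_cases hcard : (univ.filter fun i => 0.337 < b i).card ≤ 2
  · have := card_ge_of_card_large_le_two b hδ' (fun i => (hpos i).le) hle hsum hcard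
    rw [Fintype.card_fin] at this
    linarith
  · obtain ⟨i, j, k, hi, hj, hk, hij, hik, hjk⟩ := two_lt_card_iff.1 (not_le.1 hcard)
    have hi' := (mem_filter.1 hi).2
    have hj' := (mem_filter.1 hj).2
    have hk' := (mem_filter.1 hk).2
    have := two_pow_le_eight_mul_card_of_add_add_ge b (θ := 1 + 4 * δ) hij hik hjk
      (by norm_num at hδ' hi' hj' hk' ⊢; linarith)
    rw [Fintype.card_fin] at this
    have hcast : (2 : ℝ) ^ m ≤ 8 * ((univ.filter fun ε : Fin m → Bool =>
        1 + 4 * δ ≤ |signSum b ε|).card : ℝ) := by exact_mod_cast this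
    linarith
end

section
/- Let f be a real-valued random variable on a probability space with E[f] = 0 and E[f^2] < ∞. Then (E[|f|])^2 ≤ 4 · Pr[f > 0] · Pr[f ≤ 0] · E[f^2]. -/
open MeasureTheory

/-- **Lemma (first moment versus second moment and sign probabilities).**
Let `f` be a real-valued random variable on a probability space with `E[f] = 0` and
`E[f²] < ∞` (i.e. `f` and `f²` are integrable). Then
`(E[|f|])² ≤ 4 · Pr[f > 0] · Pr[f ≤ 0] · E[f²]`. -/
theorem abs_expectation_sq_le_four_mul_prob_mul_second_moment
    {Ω : Type*} [MeasurableSpace Ω] (μ : Measure Ω) [IsProbabilityMeasure μ]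
    (f : Ω → ℝ)
    (hf1 : Integrable f μ)
    (hf2 : Integrable (fun ω => f ω ^ 2) μ)
    (hmean : ∫ ω, f ω ∂μ = 0) :
    (∫ ω, |f ω| ∂μ) ^ 2 ≤
      4 * (μ {ω | 0 < f ω}).toReal * (μ {ω | f ω ≤ 0}).toReal * ∫ ω, f ω ^ 2 ∂μ := by
  have hS : NullMeasurableSet {ω | 0 < f ω} μ :=
    nullMeasurableSet_lt aemeasurable_const hf1.aemeasurable
  set S : Set Ω := {ω | 0 < f ω} with hSdef
  have hSc : {ω | f ω ≤ 0} = Sᶜ := by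
    ext ω
    simp [hSdef]
  rw [hSc]
  change _ ≤ 4 * μ.real S * μ.real Sᶜ * _
  have hpq : μ.real Sᶜ = 1 - μ.real S := probReal_compl_eq_one_sub₀ hS
  rw [hpq]
  set p := μ.real S with hp
  have hind : Integrable (S.indicator fun _ => (1 : ℝ)) μ :=
    (integrable_const (1 : ℝ)).indicator₀ hS
  have hind_int : ∫ ω, S.indicator (fun _ => (1 : ℝ)) ω ∂μ = p := by
    rw [integral_indicator₀ hS]
    simp [hp]
  have habs : Integrable (fun ω => |f ω|) μ := hf1.abs
  have key (t : ℝ) : 0 ≤ (4 * p * (1 - p)) * (t * t) +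
      (-2 * ∫ ω, |f ω| ∂μ) * t + ∫ ω, f ω ^ 2 ∂μ := by
    have hint : 0 ≤ ∫ ω, (f ω ^ 2 + (-2 * t) * |f ω| + (2 * t * (2 * p - 1)) * f ω +
        (t ^ 2 * (4 * (1 - p) ^ 2 - 4 * p ^ 2)) * S.indicator (fun _ => (1 : ℝ)) ω +
        t ^ 2 * (4 * p ^ 2)) ∂μ := by
      refine integral_nonneg fun ω => ?_
      rw [Pi.zero_apply]
      by_cases h : 0 < f ω
      · have hmem : ω ∈ S := h
        rw [Set.indicator_of_mem hmem, abs_of_pos h]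
        nlinarith [sq_nonneg (f ω - t * (2 * (1 - p)))]
      · have hmem : ω ∉ S := h
        rw [Set.indicator_of_notMem hmem, abs_of_nonpos (not_lt.mp h)]
        nlinarith [sq_nonneg (f ω + t * (2 * p))]
    rw [integral_add (by fun_prop) (by fun_prop), integral_add (by fun_prop) (by fun_prop),
      integral_add (by fun_prop) (by fun_prop), integral_add (by fun_prop) (by fun_prop)] at hint
    simp only [integral_const_mul, hmean, hind_int, integral_const, probReal_univ,
      one_smul] at hint
    linarith
  have hdiscrim := discrim_le_zero key
  rw [discrim] at hdiscrim
  linarith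
end
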